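/- (Existence and uniqueness of the immediate parent.) For every process set λ ∈ B(G) with λ ≠ {1,…,k}, the family {μ ∈ B(G) : λ ⊊ μ} of strict supersets of λ in B(G) is nonempty and has a least element under inclusion; this least strict superset is the immediate parent of λ in the tree structure on B(G). -/

import Mathlib

/-- `nodeG g p` is the set of indices `i` such that `p` is a prefix of the trajectory `g i`. -/
noncomputable def nodeG {α : Type*} {k : ℕ} (g : Fin k → List α) (p : List α) :
    Finset (Fin k) :=
  @Finset.filter _ (fun i => p <+: g i) (Classical.decPred _) Finset.univ

/-- `BG g` is the family of process sets: nonempty sets of the form `nodeG g p`. -/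
def BG {α : Type*} {k : ℕ} (g : Fin k → List α) : Set (Finset (Fin k)) :=
  {L | ∃ p : List α, (nodeG g p).Nonempty ∧ nodeG g p = L}

/-- `eG g L` is the length of the longest common prefix of the trajectories `g i`, `i ∈ L`. -/
noncomputable def eG {α : Type*} {k : ℕ} (g : Fin k → List α) (L : Finset (Fin k)) : ℕ :=
  sSup {n : ℕ | ∃ p : List α, p.length = n ∧ ∀ i ∈ L, p <+: g i}

-- The immediate parent of a process set: its least strict superset in `BG g`.
open Classical in
noncomputable def parentG {α : Type*} {k : ℕ} (g : Fin k → List α) (L : Finset (Fin k)) :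
    Finset (Fin k) :=
  if h : ∃ M, M ∈ BG g ∧ L ⊂ M ∧ ∀ M' ∈ BG g, L ⊂ M' → M ⊆ M' then h.choose
  else Finset.univ

/-- Start index of the process step of `L`: `0` for the root, `eG g (parentG g L)` otherwise. -/
noncomputable def sG {α : Type*} {k : ℕ} (g : Fin k → List α) (L : Finset (Fin k)) : ℕ :=
  if L = Finset.univ then 0 else eG g (parentG g L)

/-- `XtG g t` is the family of process sets whose token span contains the index `t`. -/
noncomputable def XtG {α : Type*} {k : ℕ} (g : Fin k → List α) (t : ℕ) :
    Finset (Finset (Fin k)) :=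
  @Finset.filter _ (fun L => L ∈ BG g ∧ sG g L ≤ t ∧ t < eG g L)
    (Classical.decPred _) Finset.univ

/-- Mean of the rewards. -/
noncomputable def rmeanG {k : ℕ} (r : Fin k → ℝ) : ℝ := (∑ i, r i) / k

/-- Standard deviation of the rewards. -/
noncomputable def rstdG {k : ℕ} (r : Fin k → ℝ) : ℝ :=
  Real.sqrt ((∑ i, (r i - rmeanG r) ^ 2) / k)

/-- Outcome-level advantage `a_i`. -/
noncomputable def advG {k : ℕ} (r : Fin k → ℝ) (i : Fin k) : ℝ :=
  (r i - rmeanG r) / rstdG r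

/-- Step-level reward `R̂(λ)`. -/
noncomputable def RhatG {k : ℕ} (r : Fin k → ℝ) (L : Finset (Fin k)) : ℝ :=
  (∑ i ∈ L, r i) / L.card

/-- Step-level advantage `Â(λ)`. -/
noncomputable def AhatG {k : ℕ} (r : Fin k → ℝ) (L : Finset (Fin k)) : ℝ :=
  (RhatG r L - rmeanG r) / rstdG r

theorem mem_nodeG {α : Type*} {k : ℕ} (g : Fin k → List α) (p : List α) (i : Fin k) :
    i ∈ nodeG g p ↔ p <+: g i := by
  simp [nodeG]

theorem nodeG_anti {α : Type*} {k : ℕ} (g : Fin k → List α) {p q : List α} (h : p <+: q) :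
    nodeG g q ⊆ nodeG g p := fun i hi =>
  (mem_nodeG g p i).2 (h.trans ((mem_nodeG g q i).1 hi))

theorem univ_mem_BG {α : Type*} {k : ℕ} (hk : 1 ≤ k) (g : Fin k → List α) :
    Finset.univ ∈ BG g := by
  have h : nodeG g [] = Finset.univ := by
    ext i
    simp [mem_nodeG]
  exact ⟨[], h ▸ ⟨⟨0, hk⟩, Finset.mem_univ _⟩, h⟩

/-- Process sets sharing an index are comparable under inclusion. -/
theorem BG_subset_or_subset {α : Type*} {k : ℕ} {g : Fin k → List α} {M N : Finset (Fin k)}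
    (hM : M ∈ BG g) (hN : N ∈ BG g) {i : Fin k} (hiM : i ∈ M) (hiN : i ∈ N) :
    M ⊆ N ∨ N ⊆ M := by
  obtain ⟨p, -, rfl⟩ := hM
  obtain ⟨q, -, rfl⟩ := hN
  rw [mem_nodeG] at hiM hiN
  exact (List.prefix_or_prefix_of_prefix hiM hiN).symm.imp (nodeG_anti g) (nodeG_anti g)

/-- **Existence and uniqueness of the immediate parent.** For every non-root process set
`λ ∈ B(G)`, the family of strict supersets of `λ` in `B(G)` is nonempty and has a (unique)
least element under inclusion. -/
theorem immediate_parent_exists_unique {α : Type*} {k : ℕ} (hk : 1 ≤ k)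
    (g : Fin k → List α) (L : Finset (Fin k)) (hL : L ∈ BG g) (hroot : L ≠ Finset.univ) :
    ∃! M, M ∈ BG g ∧ L ⊂ M ∧ ∀ M' ∈ BG g, L ⊂ M' → M ⊆ M' := by
  obtain ⟨i, hi⟩ : L.Nonempty := by
    obtain ⟨p, hp, rfl⟩ := hL
    exact hp
  obtain ⟨M, hM⟩ := (Set.toFinite {M | M ∈ BG g ∧ L ⊂ M}).exists_minimal
    ⟨Finset.univ, univ_mem_BG hk g, Finset.ssubset_univ_iff.2 hroot⟩
  obtain ⟨hMB, hLM⟩ := hM.prop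
  have hleast : ∀ M' ∈ BG g, L ⊂ M' → M ⊆ M' := fun M' hM' hLM' =>
    (BG_subset_or_subset hMB hM' (hLM.subset hi) (hLM'.subset hi)).elim id
      (hM.le_of_le ⟨hM', hLM'⟩)
  exact ⟨M, ⟨hMB, hLM, hleast⟩, fun N ⟨hNB, hLN, hN⟩ =>
    (hN M hMB hLM).antisymm (hleast N hNB hLN)⟩
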